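/- Suppose μ satisfies a logarithmic Sobolev inequality with constant C_{LS}(μ) and μ(e^{-F}) = 1. Assume there exist α > 1 and β, θ > 0 such that μ_F(e^{α F}) < ∞, μ_F(e^{β |∇F|²}) < ∞, and δ := C_{LS}(μ)(1+θ)/(4β) + 1/α < 1. Then μ_F satisfies a logarithmic Sobolev inequality with C_{LS}(μ_F) ≤ (1/(1−δ)) [ C_{LS}(μ)(1+θ⁻¹) + C_P(μ_F) ( 2 + C_{LS}(μ)((1+θ)/(4β)) ln μ_F(e^{β|∇F|²}) + (1/α) ln μ_F(e^{α F}) ) ]. -/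

import Mathlib

open MeasureTheory Real Set
open scoped ENNReal RealInnerProductSpace Pointwise Matrix

noncomputable section

/-- Euclidean space ℝ^n. -/
abbrev En (n : ℕ) := EuclideanSpace ℝ (Fin n)

/-- Test functions: smooth, bounded and Lipschitz. -/
def IsTestFun {n : ℕ} (f : En n → ℝ) : Prop :=
  ContDiff ℝ (⊤ : ℕ∞) f ∧ (∃ M, ∀ x, |f x| ≤ M) ∧ ∃ L, LipschitzWith L f

/-- `μ` satisfies a Poincaré inequality with constant `C`. -/
def PoincareLE {n : ℕ} (μ : Measure (En n)) (C : ℝ) : Prop :=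
  ∀ f : En n → ℝ, IsTestFun f →
    (∫ x, (f x) ^ 2 ∂μ) - (∫ x, f x ∂μ) ^ 2 ≤ C * ∫ x, ‖gradient f x‖ ^ 2 ∂μ

/-- `μ` satisfies a logarithmic Sobolev inequality with constant `C`. -/
def LogSobolevLE {n : ℕ} (μ : Measure (En n)) (C : ℝ) : Prop :=
  ∀ f : En n → ℝ, IsTestFun f →
    (∫ x, (f x) ^ 2 * Real.log ((f x) ^ 2) ∂μ)
        - (∫ x, (f x) ^ 2 ∂μ) * Real.log (∫ x, (f x) ^ 2 ∂μ)
      ≤ C * ∫ x, ‖gradient f x‖ ^ 2 ∂μ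

/-- `μ` satisfies an L¹-Poincaré inequality (around the mean) with constant `C`. -/
def CheegerMeanLE {n : ℕ} (μ : Measure (En n)) (C : ℝ) : Prop :=
  ∀ f : En n → ℝ, IsTestFun f →
    ∫ x, |f x - ∫ y, f y ∂μ| ∂μ ≤ C * ∫ x, ‖gradient f x‖ ∂μ

/-- `m` is a median of `f` under `μ`. -/
def IsMedian {n : ℕ} (μ : Measure (En n)) (f : En n → ℝ) (m : ℝ) : Prop :=
  ENNReal.ofReal (1 / 2) ≤ μ {x | f x ≤ m} ∧ ENNReal.ofReal (1 / 2) ≤ μ {x | m ≤ f x}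

/-- `μ` satisfies a Cheeger inequality (around medians) with constant `C`. -/
def CheegerMedianLE {n : ℕ} (μ : Measure (En n)) (C : ℝ) : Prop :=
  ∀ f : En n → ℝ, IsTestFun f → ∀ m : ℝ, IsMedian μ f m →
    ∫ x, |f x - m| ∂μ ≤ C * ∫ x, ‖gradient f x‖ ∂μ

/-- The perturbed (normalized) measure `μ_F = Z_F⁻¹ e^{-F} μ`. -/
def perturb {n : ℕ} (μ : Measure (En n)) (F : En n → ℝ) : Measure (En n) :=
  (ENNReal.ofReal (∫ x, Real.exp (-F x) ∂μ))⁻¹ •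
    μ.withDensity fun x => ENNReal.ofReal (Real.exp (-F x))

/-- Topological support of a measure. -/
def measSupport {n : ℕ} (μ : Measure (En n)) : Set (En n) :=
  {x | ∀ U ∈ nhds x, 0 < μ U}

/-- `μ` is log-concave: it has density `e^{-W}` on a convex set, with `W` convex
(equivalently, density `e^{-W}` with `W : ℝⁿ → ℝ ∪ {+∞}` convex). -/
def IsLogConcave {n : ℕ} (μ : Measure (En n)) : Prop :=
  ∃ (s : Set (En n)) (W : En n → ℝ), Convex ℝ s ∧ ConvexOn ℝ s W ∧
    μ = volume.withDensity (s.indicator fun x => ENNReal.ofReal (Real.exp (-W x)))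

/-- The Laplacian of `F`. -/
def laplacian {n : ℕ} (F : En n → ℝ) (x : En n) : ℝ :=
  ∑ i : Fin n,
    fderiv ℝ (fun y => fderiv ℝ F y (EuclideanSpace.single i (1 : ℝ))) x
      (EuclideanSpace.single i (1 : ℝ))

/-- The generator `A F = ΔF - ∇V·∇F` associated with `μ = e^{-V} dx`. -/
def genA {n : ℕ} (V F : En n → ℝ) (x : En n) : ℝ :=
  laplacian F x - ⟪gradient V x, gradient F x⟫

/-- The centered Gaussian measure on ℝ^n with covariance matrix `σ² Id`. -/
def gaussMeasure (n : ℕ) (σ : ℝ) : Measure (En n) :=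
  volume.withDensity fun x =>
    ENNReal.ofReal ((2 * π * σ ^ 2) ^ (-(n : ℝ) / 2) * Real.exp (-‖x‖ ^ 2 / (2 * σ ^ 2)))

/-- Convolution of two measures. -/
def mconv {n : ℕ} (μ ν : Measure (En n)) : Measure (En n) :=
  (μ.prod ν).map fun p => p.1 + p.2

/-- Concentration profile of `μ`. -/
def concProfile {n : ℕ} (μ : Measure (En n)) (r : ℝ) : ℝ :=
  sSup {t | ∃ A : Set (En n), MeasurableSet A ∧ (1 : ℝ) / 2 ≤ (μ A).toReal ∧
    t = 1 - (μ (A + Metric.ball (0 : En n) r)).toReal}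

/-- Generalized inverse of the concentration profile. -/
def concInv {n : ℕ} (μ : Measure (En n)) (s : ℝ) : ℝ :=
  sInf {r | 0 < r ∧ concProfile μ r ≤ s}

/-- The Hessian matrix of `V` at `x`. -/
def hessMat {n : ℕ} (V : En n → ℝ) (x : En n) : Matrix (Fin n) (Fin n) ℝ :=
  fun i j =>
    fderiv ℝ (fun y => fderiv ℝ V y (EuclideanSpace.single j (1 : ℝ))) x
      (EuclideanSpace.single i (1 : ℝ))

end

section Minorants

open Filter Topology Metric

variable {E : Type*} [NormedAddCommGroup E]

/-- `v` is a Lipschitz function with values between `-M` and `g` whose asymptotic Lipschitz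
constant at each point `x` is at most `σ x`. -/
structure IsSlopeMinorant (σ : E → ℝ≥0∞) (M : ℝ) (g v : E → ℝ) : Prop where
  lipschitz : ∃ K, LipschitzWith K v
  neg_le : ∀ x, -M ≤ v x
  le : ∀ x, v x ≤ g x
  slope : ∀ x, ∀ s : NNReal, σ x < s → ∃ U ∈ 𝓝 x, LipschitzOnWith s v U

theorem LipschitzOnWith.of_eqOn {s : NNReal} {f g : E → ℝ} {U : Set E}
    (hf : LipschitzOnWith s f U) (hfg : EqOn g f U) : LipschitzOnWith s g U := fun x hx y hy => by
  rw [hfg hx, hfg hy]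
  exact hf hx hy

theorem LipschitzOnWith.sup_same {s : NNReal} {f g : E → ℝ} {U : Set E}
    (hf : LipschitzOnWith s f U) (hg : LipschitzOnWith s g U) :
    LipschitzOnWith s (fun x => max (f x) (g x)) U := by
  rw [lipschitzOnWith_iff_restrict] at *
  exact (max_self s) ▸ hf.max hg

namespace IsSlopeMinorant

variable {σ : E → ℝ≥0∞} {M : ℝ} {g v w : E → ℝ}

theorem continuous (hv : IsSlopeMinorant σ M g v) : Continuous v :=
  hv.lipschitz.choose_spec.continuous

theorem const (hg : ∀ x, -M ≤ g x) : IsSlopeMinorant σ M g fun _ => -M where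
  lipschitz := ⟨0, LipschitzWith.const _⟩
  neg_le _ := le_rfl
  le := hg
  slope _ _ _ := ⟨univ, univ_mem, ((LipschitzWith.const _).weaken zero_le).lipschitzOnWith⟩

theorem max (hv : IsSlopeMinorant σ M g v) (hw : IsSlopeMinorant σ M g w) :
    IsSlopeMinorant σ M g fun x => max (v x) (w x) where
  lipschitz := by
    obtain ⟨K, hK⟩ := hv.lipschitz
    obtain ⟨L, hL⟩ := hw.lipschitz
    exact ⟨_, hK.max hL⟩
  neg_le x := (hv.neg_le x).trans (le_max_left _ _)
  le x := max_le (hv.le x) (hw.le x)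
  slope x s hs := by
    obtain ⟨U, hU, hvU⟩ := hv.slope x s hs
    obtain ⟨W, hW, hwW⟩ := hw.slope x s hs
    exact ⟨U ∩ W, inter_mem hU hW,
      (hvU.mono inter_subset_left).sup_same (hwW.mono inter_subset_right)⟩

/-- A family of minorants beating a continuous function at each point of a compact set contains
one beating it on the whole compact set. -/
theorem exists_forall_lt (hg : ∀ x, -M ≤ g x) {K : Set E} (hK : IsCompact K) {φ : E → ℝ}
    (hφ : Continuous φ) (h : ∀ y ∈ K, ∃ v, IsSlopeMinorant σ M g v ∧ φ y < v y) :
    ∃ v, IsSlopeMinorant σ M g v ∧ ∀ y ∈ K, φ y < v y := by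
  refine hK.induction_on (p := fun s => ∃ v, IsSlopeMinorant σ M g v ∧ ∀ y ∈ s, φ y < v y)
    ⟨_, const hg, by simp⟩ ?_ ?_ ?_
  · rintro s t hst ⟨v, hv, h⟩
    exact ⟨v, hv, fun y hy => h y (hst hy)⟩
  · rintro s t ⟨v, hv, h⟩ ⟨w, hw, h'⟩
    refine ⟨_, hv.max hw, ?_⟩
    rintro y (hy | hy)
    exacts [(h y hy).trans_le (le_max_left _ _), (h' y hy).trans_le (le_max_right _ _)]
  · intro y hy
    obtain ⟨v, hv, h⟩ := h y hy
    exact ⟨_, mem_nhdsWithin_of_mem_nhds ((hφ.continuousAt).eventually_lt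
      hv.continuous.continuousAt h), v, hv, fun z hz => hz⟩

variable [NormedSpace ℝ E]

/-- A segment joining a point of a closed ball to a point outside the ball meets the sphere. -/
theorem exists_sphere_of_mem_closedBall {z x y : E} {r : ℝ} (hx : dist x z ≤ r)
    (hy : r < dist y z) : ∃ p, dist p z = r ∧ dist x p ≤ dist x y ∧ dist p y ≤ dist x y := by
  have hc : Continuous fun t : ℝ => dist (AffineMap.lineMap x y t) z := by
    have := AffineMap.lineMap_continuous (R := ℝ) (p := x) (q := y)
    fun_prop
  obtain ⟨t, ht, hpt⟩ := intermediate_value_Icc (zero_le_one' ℝ) hc.continuousOn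
    (show r ∈ Icc _ _ by simpa using ⟨hx, hy.le⟩)
  refine ⟨_, hpt, ?_, ?_⟩
  · rw [dist_left_lineMap, Real.norm_of_nonneg ht.1]
    exact mul_le_of_le_one_left dist_nonneg ht.2
  · rw [dist_lineMap_right, Real.norm_of_nonneg (by linarith [ht.2])]
    exact mul_le_of_le_one_left dist_nonneg (by linarith [ht.1])

/-- Gluing a cone on a ball to a minorant which is larger than the cone on the sphere. -/
theorem exists_ge_cone (hv : IsSlopeMinorant σ M g v) {z : E} {r A : ℝ} {s : NNReal} (hr : 0 < r)
    (hσ : ∀ x ∈ closedBall z r, (s : ℝ≥0∞) < σ x)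
    (hle : ∀ x ∈ closedBall z r, A - s * dist x z ≤ g x)
    (hlt : ∀ x ∈ sphere z r, A - s * dist x z < v x) :
    ∃ w, IsSlopeMinorant σ M g w ∧ A ≤ w z := by
  classical
  set c : E → ℝ := fun x => A - s * dist x z with hc
  have hcL : LipschitzWith s c := by
    refine LipschitzWith.of_dist_le_mul fun x y => ?_
    have := abs_dist_sub_le x y z
    rw [Real.dist_eq, hc]
    calc |A - s * dist x z - (A - s * dist y z)| = |s * (dist y z - dist x z)| := by
          congr 1; ring
      _ = s * |dist x z - dist y z| := by
          rw [abs_mul, abs_sub_comm (dist y z), NNReal.abs_eq]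
      _ ≤ s * dist x y := by gcongr
  set w : E → ℝ := fun x => if dist x z ≤ r then Max.max (v x) (c x) else v x with hw
  have hw_in : ∀ x, dist x z ≤ r → w x = Max.max (v x) (c x) := fun x hx => if_pos hx
  have hw_out : ∀ x, r ≤ dist x z → w x = v x := by
    intro x hx
    rcases hx.eq_or_lt with h | h
    · rw [hw_in x h.ge, max_eq_left (hlt x h.symm).le]
    · exact if_neg h.not_ge
  obtain ⟨K, hK⟩ := hv.lipschitz
  have hmax := hK.max hcL
  have hout : ∀ x y, r ≤ dist x z → r ≤ dist y z → dist (w x) (w y) ≤ K * dist x y := by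
    intro x y hx hy
    rw [hw_out x hx, hw_out y hy]
    exact hK.dist_le_mul x y
  have hin : ∀ x y, dist x z ≤ r → dist y z ≤ r →
      dist (w x) (w y) ≤ Max.max K s * dist x y := by
    intro x y hx hy
    rw [hw_in x hx, hw_in y hy]
    exact hmax.dist_le_mul x y
  have hmix : ∀ x y, dist x z ≤ r → r < dist y z →
      dist (w x) (w y) ≤ (Max.max K s + K : NNReal) * dist x y := by
    intro x y hx hy
    obtain ⟨p, hp, h1, h2⟩ := exists_sphere_of_mem_closedBall hx hy
    push_cast
    calc dist (w x) (w y) ≤ dist (w x) (w p) + dist (w p) (w y) := dist_triangle _ _ _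
      _ ≤ Max.max K s * dist x p + K * dist p y :=
          add_le_add (hin x p hx hp.le) (hout p y hp.ge hy.le)
      _ ≤ Max.max K s * dist x y + K * dist x y := by gcongr
      _ = _ := by push_cast; ring
  refine ⟨w, ⟨⟨Max.max K s + K, LipschitzWith.of_dist_le_mul fun x y => ?_⟩, ?_, ?_, ?_⟩, ?_⟩
  · rcases le_or_gt (dist x z) r with hx | hx <;> rcases le_or_gt (dist y z) r with hy | hy
    · refine (hin x y hx hy).trans ?_
      gcongr
      simp
    · exact hmix x y hx hy
    · rw [dist_comm, dist_comm x y]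
      exact hmix y x hy hx
    · refine (hout x y hx.le hy.le).trans ?_
      gcongr
      simp
  · intro x
    by_cases hx : dist x z ≤ r
    · rw [hw_in x hx]; exact (hv.neg_le x).trans (le_max_left _ _)
    · rw [hw_out x (le_of_not_ge hx)]; exact hv.neg_le x
  · intro x
    by_cases hx : dist x z ≤ r
    · rw [hw_in x hx]; exact max_le (hv.le x) (hle x hx)
    · rw [hw_out x (le_of_not_ge hx)]; exact hv.le x
  · intro x t ht
    obtain ⟨U, hU, hvU⟩ := hv.slope x t ht
    rcases lt_trichotomy (dist x z) r with hx | hx | hx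
    · refine ⟨U ∩ ball z r, inter_mem hU (isOpen_ball.mem_nhds hx), ?_⟩
      have hst : s ≤ t := by exact_mod_cast ((hσ x hx.le).trans ht).le
      refine LipschitzOnWith.of_eqOn ((hvU.mono inter_subset_left).sup_same
        ((hcL.weaken hst).lipschitzOnWith (s := U ∩ ball z r))) fun y hy => ?_
      exact (hw_in y (mem_ball.1 hy.2).le)
    · have : {y | c y < v y} ∈ 𝓝 x :=
        hcL.continuous.continuousAt.eventually_lt hv.continuous.continuousAt (hlt x hx)
      refine ⟨U ∩ {y | c y < v y}, inter_mem hU this, ?_⟩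
      refine LipschitzOnWith.of_eqOn (hvU.mono inter_subset_left) fun y hy => ?_
      by_cases hyr : dist y z ≤ r
      · rw [hw_in y hyr, max_eq_left (le_of_lt hy.2)]
      · exact hw_out y (le_of_not_ge hyr)
    · have : {y | r < dist y z} ∈ 𝓝 x := (isOpen_lt (by fun_prop) (by fun_prop)).mem_nhds hx
      refine ⟨U ∩ {y | r < dist y z}, inter_mem hU this, ?_⟩
      exact LipschitzOnWith.of_eqOn (hvU.mono inter_subset_left) fun y hy => hw_out y (le_of_lt hy.2)
  · rw [hw_in z (by simpa using hr.le)]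
    simp [hc]

/-- Perron's method: a bounded continuous function whose slope is strictly below a lower
semicontinuous `σ` is the supremum of the Lipschitz minorants of slope at most `σ`. -/
theorem exists_lt_apply [ProperSpace E] {M' c : ℝ} {ρ : E → ℝ} (hgc : Continuous g)
    (hg : ∀ x, -M ≤ g x) (hg' : ∀ x, g x ≤ M') (hρ : ∀ x, 0 ≤ ρ x) (hc : 0 < c)
    (hslope : ∀ z, ∀ η > 0, ∀ᶠ y in 𝓝 z, g z - (ρ z + η) * dist y z ≤ g y)
    (hσ : LowerSemicontinuous σ) (hρσ : ∀ x, ENNReal.ofReal (ρ x + c) ≤ σ x)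
    (x₀ : E) {η : ℝ} (hη : 0 < η) :
    ∃ v, IsSlopeMinorant σ M g v ∧ g x₀ - η < v x₀ := by
  by_contra! hcon
  let S := {v : E → ℝ // IsSlopeMinorant σ M g v}
  have : Nonempty S := ⟨⟨_, const hg⟩⟩
  let h : E → ℝ := fun x => ⨆ v : S, v.1 x
  have hbdd : ∀ x, BddAbove (range fun v : S => v.1 x) := fun x =>
    ⟨g x, by rintro _ ⟨v, rfl⟩; exact v.2.le x⟩
  have hle_h : ∀ v, IsSlopeMinorant σ M g v → ∀ x, v x ≤ h x := fun v hv x =>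
    le_ciSup (hbdd x) (⟨v, hv⟩ : S)
  have hM : ∀ x, -M ≤ h x := fun x => hle_h _ (const hg) x
  have hlsc : LowerSemicontinuous h :=
    lowerSemicontinuous_ciSup hbdd fun v => v.2.continuous.lowerSemicontinuous
  let q : E → ℝ := fun x => h x + (c / 4 * dist x x₀ - g x)
  have hq : LowerSemicontinuous q := by
    refine hlsc.add (Continuous.lowerSemicontinuous ?_)
    fun_prop
  have hq₀ : q x₀ ≤ -η := by
    have : h x₀ ≤ g x₀ - η := ciSup_le fun v => hcon v.1 v.2
    simp only [q, dist_self]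
    linarith
  have hMM : 0 ≤ M + M' := by linarith [hg x₀, hg' x₀]
  obtain ⟨z, hz, hzmin⟩ := LowerSemicontinuousOn.exists_isMinOn
    (s := closedBall x₀ (4 / c * (M + M'))) ⟨x₀, mem_closedBall_self (by positivity)⟩
    (isCompact_closedBall _ _) (hq.lowerSemicontinuousOn _)
  have hzq₀ : q z ≤ q x₀ := hzmin (mem_closedBall_self (by positivity))
  have hglob : ∀ y, q z ≤ q y := by
    intro y
    by_cases hy : y ∈ closedBall x₀ (4 / c * (M + M'))
    · exact hzmin hy
    · have h1 : 4 / c * (M + M') < dist y x₀ := by simpa using hy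
      have h2 : M + M' ≤ c / 4 * dist y x₀ := by
        calc M + M' = c / 4 * (4 / c * (M + M')) := by field_simp
          _ ≤ _ := by gcongr
      have : 0 ≤ q y := by
        simp only [q]; linarith [hM y, hg' y]
      linarith
  have hzη : h z ≤ g z - η := by
    have : q z ≤ -η := hzq₀.trans hq₀
    have h0 : 0 ≤ c / 4 * dist z x₀ := by positivity
    simp only [q] at this
    linarith
  let s : NNReal := ⟨ρ z + 3 * c / 4, by have := hρ z; positivity⟩
  have hs : (s : ℝ) = ρ z + 3 * c / 4 := rfl
  have hsσ : (s : ℝ≥0∞) < σ z := by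
    refine lt_of_lt_of_le ?_ (hρσ z)
    rw [← ENNReal.ofReal_coe_nnreal, hs]
    exact (ENNReal.ofReal_lt_ofReal_iff (by linarith [hρ z])).2 (by linarith)
  obtain ⟨r, hr, hball⟩ := nhds_basis_closedBall.mem_iff.1
    ((hσ z _ hsσ).and (hslope z (c / 4) (by positivity)))
  let δ := min (c * r / 8) η
  have hδ : 0 < δ := lt_min (by positivity) hη
  have hδ1 : δ ≤ c * r / 8 := min_le_left _ _
  have hδ2 : δ ≤ η := min_le_right _ _
  have hsphere : ∀ y ∈ sphere z r,
      ∃ v, IsSlopeMinorant σ M g v ∧ h z + δ - s * dist y z < v y := by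
    intro y hy
    have hyr : dist y z = r := hy
    have h1 := hglob y
    have h2 := (hball (sphere_subset_closedBall hy)).2
    have h3 : dist y x₀ ≤ dist y z + dist z x₀ := dist_triangle _ _ _
    have h4 : c / 4 * dist y x₀ ≤ c / 4 * (dist y z + dist z x₀) := by gcongr
    have hlt : h z + δ - s * dist y z < h y := by
      simp only [q] at h1
      rw [hyr] at h2 h4 ⊢
      rw [hs]
      nlinarith
    obtain ⟨v, hv⟩ := exists_lt_of_lt_ciSup hlt
    exact ⟨v.1, v.2, hv⟩
  obtain ⟨v, hv, hvlt⟩ := exists_forall_lt hg (isCompact_sphere z r)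
    (φ := fun y => h z + δ - s * dist y z) (by fun_prop) hsphere
  obtain ⟨w, hw, hwz⟩ := hv.exists_ge_cone hr (fun x hx => (hball hx).1) (fun x hx => by
    have h2 := (hball hx).2
    have : 0 ≤ c / 2 * dist x z := by positivity
    rw [hs]
    nlinarith) hvlt
  linarith [hle_h w hw z]

/-- Approximation from below, pointwise along a sequence. -/
theorem exists_seq_tendsto [ProperSpace E] {M' c : ℝ} {ρ : E → ℝ} (hgc : Continuous g)
    (hg : ∀ x, -M ≤ g x) (hg' : ∀ x, g x ≤ M') (hρ : ∀ x, 0 ≤ ρ x) (hc : 0 < c)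
    (hslope : ∀ z, ∀ η > 0, ∀ᶠ y in 𝓝 z, g z - (ρ z + η) * dist y z ≤ g y)
    (hσ : LowerSemicontinuous σ) (hρσ : ∀ x, ENNReal.ofReal (ρ x + c) ≤ σ x) :
    ∃ v : ℕ → E → ℝ, (∀ k, IsSlopeMinorant σ M g (v k)) ∧
      ∀ x, Tendsto (fun k => v k x) atTop (𝓝 (g x)) := by
  have key : ∀ k : ℕ, ∃ v, IsSlopeMinorant σ M g v ∧
      ∀ y ∈ closedBall (0 : E) k, g y - 1 / ((k : ℝ) + 1) < v y := fun k =>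
    exists_forall_lt hg (isCompact_closedBall _ _) (by fun_prop) fun y _ =>
      exists_lt_apply hgc hg hg' hρ hc hslope hσ hρσ y (by positivity)
  choose v hv hvg using key
  refine ⟨v, hv, fun x => ?_⟩
  have h0 : Tendsto (fun k : ℕ => g x - 1 / ((k : ℝ) + 1)) atTop (𝓝 (g x)) := by
    simpa using tendsto_one_div_add_atTop_nhds_zero_nat.const_sub (g x)
  refine tendsto_of_tendsto_of_tendsto_of_le_of_le' h0 tendsto_const_nhds ?_
    (Eventually.of_forall fun k => (hv k).le x)
  filter_upwards [eventually_ge_atTop ⌈‖x‖⌉₊] with k hk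
  exact (hvg k x (by simpa using Nat.ceil_le.1 hk)).le

end IsSlopeMinorant

end Minorants

section Mollification

open Filter Topology Metric
open scoped Convolution

variable {n : ℕ}

theorem norm_gradient_eq (f : En n → ℝ) (x : En n) : ‖gradient f x‖ = ‖fderiv ℝ f x‖ := by
  simp [gradient]

theorem measurable_norm_gradient (f : En n → ℝ) : Measurable fun x => ‖gradient f x‖ := by
  simp_rw [norm_gradient_eq]
  exact (measurable_fderiv ℝ f).norm

theorem ContDiffBump.convolution_apply (φ : ContDiffBump (0 : En n)) (v : En n → ℝ) (x : En n) :
    (φ.normed volume ⋆[ContinuousLinearMap.lsmul ℝ ℝ, volume] v) x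
      = ∫ t, φ.normed volume t * v (x - t) := rfl

theorem ContDiffBump.integrable_normed_mul (φ : ContDiffBump (0 : En n)) {v : En n → ℝ}
    (hv : Continuous v) : Integrable (fun t => φ.normed volume t * v t) :=
  (φ.continuous_normed.mul hv).integrable_of_hasCompactSupport φ.hasCompactSupport_normed.mul_right

theorem ContDiffBump.norm_convolution_le (φ : ContDiffBump (0 : En n)) {v : En n → ℝ} {M : ℝ}
    (hM : ∀ x, |v x| ≤ M) (x : En n) :
    |(φ.normed volume ⋆[ContinuousLinearMap.lsmul ℝ ℝ, volume] v) x| ≤ M := by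
  rw [φ.convolution_apply]
  calc |∫ t, φ.normed volume t * v (x - t)| ≤ ∫ t, φ.normed volume t * M := by
        rw [← Real.norm_eq_abs]
        refine norm_integral_le_of_norm_le ((φ.integrable_normed (μ := volume)).mul_const M)
          (Eventually.of_forall fun t => ?_)
        rw [norm_mul, Real.norm_of_nonneg (φ.nonneg_normed t)]
        exact mul_le_mul_of_nonneg_left (hM _) (φ.nonneg_normed t)
    _ = M := by rw [integral_mul_const, φ.integral_normed, one_mul]

/-- Convolution with a bump function does not increase the local Lipschitz constant. -/
theorem ContDiffBump.lipschitzOnWith_convolution (φ : ContDiffBump (0 : En n)) {v : En n → ℝ}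
    (hv : Continuous v) {s : NNReal} {U W : Set (En n)} (hU : LipschitzOnWith s v U)
    (hW : ∀ y ∈ W, ∀ t ∈ ball (0 : En n) φ.rOut, y - t ∈ U) :
    LipschitzOnWith s (φ.normed volume ⋆[ContinuousLinearMap.lsmul ℝ ℝ, volume] v) W := by
  refine LipschitzOnWith.of_dist_le_mul fun x hx y hy => ?_
  have hfi : ∀ x : En n, Integrable fun t => φ.normed volume t * v (x - t) := fun x =>
    φ.integrable_normed_mul (v := fun t => v (x - t)) (by fun_prop)
  rw [φ.convolution_apply, φ.convolution_apply, dist_eq_norm, ← integral_sub (hfi x) (hfi y)]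
  calc ‖∫ t, (φ.normed volume t * v (x - t) - φ.normed volume t * v (y - t))‖
      ≤ ∫ t, φ.normed volume t * (s * dist x y) := by
        refine norm_integral_le_of_norm_le
          ((φ.integrable_normed (μ := volume)).mul_const _)
          (Eventually.of_forall fun t => ?_)
        rw [← mul_sub, norm_mul, Real.norm_of_nonneg (φ.nonneg_normed t)]
        by_cases ht : t ∈ ball (0 : En n) φ.rOut
        · refine mul_le_mul_of_nonneg_left ?_ (φ.nonneg_normed t)
          have := hU.dist_le_mul _ (hW x hx t ht) _ (hW y hy t ht)
          rwa [dist_sub_right, dist_eq_norm (v _)] at this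
        · have : φ.normed volume t = 0 := by
            rw [← Function.notMem_support, φ.support_normed_eq]
            exact ht
          simp [this]
    _ = s * dist x y := by rw [integral_mul_const, φ.integral_normed, one_mul]

/-- A bounded Lipschitz function is a pointwise limit of test functions whose gradients are
asymptotically controlled by its local Lipschitz constants. -/
theorem exists_testFun_tendsto {v : En n → ℝ} {K : NNReal} {M : ℝ} (hv : LipschitzWith K v)
    (hM : ∀ x, |v x| ≤ M) :
    ∃ u : ℕ → En n → ℝ, (∀ k, IsTestFun (u k)) ∧ (∀ k x, |u k x| ≤ M) ∧
      (∀ x, Tendsto (fun k => u k x) atTop (𝓝 (v x))) ∧ (∀ k x, ‖gradient (u k) x‖ ≤ K) ∧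
      ∀ x, ∀ s : NNReal, ∀ U ∈ 𝓝 x, LipschitzOnWith s v U →
        ∀ᶠ k in atTop, ‖gradient (u k) x‖ ≤ s := by
  let φ : ℕ → ContDiffBump (0 : En n) := fun k =>
    ⟨1 / ((k : ℝ) + 1) / 2, 1 / ((k : ℝ) + 1), by positivity, half_lt_self (by positivity)⟩
  have hφ : Tendsto (fun k => (φ k).rOut) atTop (𝓝 0) := tendsto_one_div_add_atTop_nhds_zero_nat
  have hlip : ∀ k, LipschitzWith K
      ((φ k).normed volume ⋆[ContinuousLinearMap.lsmul ℝ ℝ, volume] v) := fun k =>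
    lipschitzOnWith_univ.1 ((φ k).lipschitzOnWith_convolution hv.continuous
      (lipschitzOnWith_univ.2 hv) fun _ _ _ _ => mem_univ _)
  refine ⟨fun k => (φ k).normed volume ⋆[ContinuousLinearMap.lsmul ℝ ℝ, volume] v,
    fun k => ⟨?_, ⟨M, (φ k).norm_convolution_le hM⟩, K, hlip k⟩,
    fun k => (φ k).norm_convolution_le hM,
    ContDiffBump.convolution_tendsto_right_of_continuous hφ hv.continuous, ?_, ?_⟩
  · exact (φ k).hasCompactSupport_normed.contDiff_convolution_left _ (φ k).contDiff_normed
      hv.continuous.locallyIntegrable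
  · intro k x
    rw [norm_gradient_eq]
    exact norm_fderiv_le_of_lipschitz ℝ (hlip k)
  · intro x s U hU hs
    obtain ⟨r, hr, hrU⟩ := nhds_basis_ball.mem_iff.1 hU
    filter_upwards [hφ.eventually_lt_const (half_pos hr)] with k hk
    rw [norm_gradient_eq]
    refine norm_fderiv_le_of_lipschitzOn ℝ (ball_mem_nhds x (half_pos hr))
      ((φ k).lipschitzOnWith_convolution hv.continuous (hs.mono hrU) fun y hy t ht => ?_)
    rw [mem_ball, dist_eq_norm] at *
    calc ‖y - t - x‖ = ‖(y - x) - (t - 0)‖ := by congr 1; abel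
      _ ≤ ‖y - x‖ + ‖t - 0‖ := norm_sub_le _ _
      _ < r := by linarith

end Mollification

section Extension

open Filter Topology Metric

variable {n : ℕ}

/-- The entropy of `f ^ 2` with respect to `μ`. -/
noncomputable def entSq {α : Type*} [MeasurableSpace α] (μ : Measure α) (f : α → ℝ) : ℝ :=
  (∫ x, (f x) ^ 2 * Real.log ((f x) ^ 2) ∂μ)
    - (∫ x, (f x) ^ 2 ∂μ) * Real.log (∫ x, (f x) ^ 2 ∂μ)

theorem sq_le_sq_of_abs_le {a M : ℝ} (h : |a| ≤ M) : a ^ 2 ≤ M ^ 2 :=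
  sq_le_sq' (abs_le.1 h).1 (abs_le.1 h).2

theorem exists_abs_sq_mul_log_le (M : ℝ) :
    ∃ B, ∀ t : ℝ, |t| ≤ M → |t ^ 2 * Real.log (t ^ 2)| ≤ B := by
  obtain ⟨B, hB⟩ := (isCompact_Icc (a := (0 : ℝ)) (b := M ^ 2)).exists_bound_of_continuousOn
    Real.continuous_mul_log.continuousOn
  exact ⟨B, fun t ht => hB _ ⟨sq_nonneg t, sq_le_sq_of_abs_le ht⟩⟩

theorem tendsto_entSq {α : Type*} [MeasurableSpace α] {μ : Measure α} [IsFiniteMeasure μ]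
    {f : ℕ → α → ℝ} {g : α → ℝ} {M : ℝ} (hf : ∀ k, Measurable (f k)) (hM : ∀ k x, |f k x| ≤ M)
    (hfg : ∀ x, Tendsto (fun k => f k x) atTop (𝓝 (g x))) :
    Tendsto (fun k => entSq μ (f k)) atTop (𝓝 (entSq μ g)) := by
  obtain ⟨B, hB⟩ := exists_abs_sq_mul_log_le M
  have h1 : Tendsto (fun k => ∫ x, (f k x) ^ 2 * Real.log ((f k x) ^ 2) ∂μ) atTop
      (𝓝 (∫ x, (g x) ^ 2 * Real.log ((g x) ^ 2) ∂μ)) := by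
    refine tendsto_integral_of_dominated_convergence (fun _ => B)
      (fun k => (Real.continuous_mul_log.measurable.comp
        ((hf k).pow_const 2)).aestronglyMeasurable) (integrable_const _)
      (fun k => Eventually.of_forall fun x => hB _ (hM k x))
      (Eventually.of_forall fun x => ?_)
    exact (Real.continuous_mul_log.tendsto _).comp ((hfg x).pow 2)
  have h2 : Tendsto (fun k => ∫ x, (f k x) ^ 2 ∂μ) atTop (𝓝 (∫ x, (g x) ^ 2 ∂μ)) := by
    refine tendsto_integral_of_dominated_convergence (fun _ => M ^ 2)
      (fun k => ((hf k).pow_const 2).aestronglyMeasurable) (integrable_const _)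
      (fun k => Eventually.of_forall fun x => ?_) (Eventually.of_forall fun x => (hfg x).pow 2)
    rw [Real.norm_of_nonneg (sq_nonneg _)]
    exact sq_le_sq_of_abs_le (hM k x)
  exact h1.sub ((Real.continuous_mul_log.tendsto _).comp h2)

theorem le_of_forall_gt_le_mul {a C L : ℝ} (h : ∀ b > L, a ≤ C * b) : a ≤ C * L := by
  have : Tendsto (fun b => C * b) (𝓝[>] L) (𝓝 (C * L)) :=
    ((continuous_const_mul C).tendsto L).mono_left nhdsWithin_le_nhds
  exact ge_of_tendsto this (eventually_mem_nhdsWithin.mono h)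

theorem LogSobolevLE.entSq_le_of_isSlopeMinorant {μ : Measure (En n)} [IsProbabilityMeasure μ]
    {C : ℝ} (hLS : LogSobolevLE μ C) (hC : 0 ≤ C) {σ : En n → ℝ≥0∞} {M M' : ℝ} {g v : En n → ℝ}
    (hv : IsSlopeMinorant σ M g v) (hM : ∀ x, |v x| ≤ M') (hσ : ∫⁻ x, σ x ^ 2 ∂μ ≠ ∞) :
    entSq μ v ≤ C * (∫⁻ x, σ x ^ 2 ∂μ).toReal := by
  obtain ⟨K, hK⟩ := hv.lipschitz
  obtain ⟨u, hu, huM, huv, huK, hus⟩ := exists_testFun_tendsto hK hM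
  have hmeas : ∀ k, Measurable fun x => ENNReal.ofReal (‖gradient (u k) x‖ ^ 2) := fun k =>
    ((measurable_norm_gradient (u k)).pow_const 2).ennreal_ofReal
  have hlim : ∀ x, limsup (fun k => ENNReal.ofReal (‖gradient (u k) x‖ ^ 2)) atTop ≤ σ x ^ 2 := by
    intro x
    by_cases hx : σ x = ∞
    · simp [hx]
    lift σ x to NNReal using hx with t ht
    have h1 : Tendsto (fun s : NNReal => (s : ℝ≥0∞) ^ 2) (𝓝[>] t) (𝓝 ((t : ℝ≥0∞) ^ 2)) := by
      have : Continuous fun s : NNReal => (s : ℝ≥0∞) ^ 2 :=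
        (ENNReal.continuous_pow 2).comp ENNReal.continuous_coe
      exact (this.tendsto t).mono_left nhdsWithin_le_nhds
    refine ge_of_tendsto h1 (eventually_mem_nhdsWithin.mono fun s hs => ?_)
    obtain ⟨U, hU, hvU⟩ := hv.slope x s (by rw [← ht]; exact_mod_cast hs)
    refine limsup_le_of_le (h := ?_)
    filter_upwards [hus x s U hU hvU] with k hk
    rw [ENNReal.ofReal_pow (norm_nonneg _)]
    gcongr
    exact ENNReal.ofReal_le_of_le_toReal (by simpa using hk)
  have hlimsup : limsup (fun k => ∫⁻ x, ENNReal.ofReal (‖gradient (u k) x‖ ^ 2) ∂μ) atTop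
      ≤ ∫⁻ x, σ x ^ 2 ∂μ := by
    refine (limsup_lintegral_le (fun _ => ENNReal.ofReal ((K : ℝ) ^ 2)) hmeas (fun k => ?_)
      (by simp)).trans (lintegral_mono hlim)
    exact Eventually.of_forall fun x => ENNReal.ofReal_le_ofReal
      (pow_le_pow_left₀ (norm_nonneg _) (huK k x) 2)
  refine le_of_forall_gt_le_mul fun b hb => ?_
  have hb0 : 0 ≤ b := ENNReal.toReal_nonneg.trans hb.le
  have hev := eventually_lt_of_limsup_lt
    (hlimsup.trans_lt ((ENNReal.lt_ofReal_iff_toReal_lt hσ).2 hb))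
  refine le_of_tendsto (tendsto_entSq (μ := μ) (fun k => (hu k).1.continuous.measurable) huM huv)
    (hev.mono fun k hk => (hLS (u k) (hu k)).trans ?_)
  gcongr
  rw [integral_eq_lintegral_of_nonneg_ae (Eventually.of_forall fun x => sq_nonneg _)
    ((measurable_norm_gradient (u k)).pow_const 2).aestronglyMeasurable]
  exact ENNReal.toReal_le_of_le_ofReal hb0 hk.le

/-- The logarithmic Sobolev inequality extends to bounded continuous functions with
square-integrable pointwise slope. -/
theorem LogSobolevLE.entSq_le_of_slope {μ : Measure (En n)} [IsProbabilityMeasure μ]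
    {C : ℝ} (hLS : LogSobolevLE μ C) (hC : 0 ≤ C) {g ρ : En n → ℝ} {M : ℝ} (hgc : Continuous g)
    (hM : ∀ x, |g x| ≤ M) (hρ : ∀ x, 0 ≤ ρ x) (hρm : Measurable ρ)
    (hρi : Integrable (fun x => ρ x ^ 2) μ)
    (hslope : ∀ z, ∀ η > 0, ∀ᶠ y in 𝓝 z, g z - (ρ z + η) * dist y z ≤ g y) :
    entSq μ g ≤ C * ∫ x, ρ x ^ 2 ∂μ := by
  set I := ∫ x, ρ x ^ 2 ∂μ with hI
  have hI0 : 0 ≤ I := integral_nonneg fun x => sq_nonneg _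
  refine le_of_forall_gt_le_mul fun b hb => ?_
  set ε := b - I with hε
  have hε0 : 0 < ε := sub_pos.2 hb
  set c := min 1 (ε / 2 / (I + 2)) with hc
  have hc0 : 0 < c := lt_min one_pos (by positivity)
  have hc1 : c ≤ 1 := min_le_left _ _
  have hc2 : c * (I + 2) ≤ ε / 2 := by
    rw [← le_div_iff₀ (by positivity)]
    exact min_le_right _ _
  have hρ2 : Integrable (fun x => ρ x ^ 2 + 2) μ := hρi.add (integrable_const 2)
  have hdom : Integrable (fun x => ρ x ^ 2 + c * (ρ x ^ 2 + 2)) μ := hρi.add (hρ2.const_mul c)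
  have hle : ∫⁻ x, ENNReal.ofReal ((ρ x + c) ^ 2) ∂μ ≤ ENNReal.ofReal (I + ε / 2) := by
    calc ∫⁻ x, ENNReal.ofReal ((ρ x + c) ^ 2) ∂μ
        ≤ ∫⁻ x, ENNReal.ofReal (ρ x ^ 2 + c * (ρ x ^ 2 + 2)) ∂μ := by
          refine lintegral_mono fun x => ENNReal.ofReal_le_ofReal ?_
          nlinarith [mul_nonneg hc0.le (sq_nonneg (ρ x - 1)), mul_nonneg hc0.le (sub_nonneg.2 hc1)]
      _ = ENNReal.ofReal (∫ x, (ρ x ^ 2 + c * (ρ x ^ 2 + 2)) ∂μ) :=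
          (ofReal_integral_eq_lintegral_ofReal hdom
            (Eventually.of_forall fun x => by dsimp only [Pi.zero_apply]; positivity)).symm
      _ ≤ ENNReal.ofReal (I + ε / 2) := by
          refine ENNReal.ofReal_le_ofReal ?_
          rw [integral_add hρi (hρ2.const_mul c), integral_const_mul,
            integral_add hρi (integrable_const 2)]
          simp only [integral_const, probReal_univ, smul_eq_mul, one_mul]
          rw [← hI]
          linarith
  obtain ⟨u, hfu, hulsc, hu⟩ := exists_le_lowerSemicontinuous_lintegral_ge μ
    (fun x => ENNReal.ofReal ((ρ x + c) ^ 2)) ((hρm.add_const c).pow_const 2).ennreal_ofReal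
    (ε := ENNReal.ofReal (ε / 2)) (by simpa using hε0)
  have hub : ∫⁻ x, u x ∂μ ≤ ENNReal.ofReal b := by
    refine (hu.trans (add_le_add_left hle _)).trans ?_
    rw [← ENNReal.ofReal_add (by positivity) (by positivity)]
    refine ENNReal.ofReal_le_ofReal (by rw [hε]; linarith)
  set σ : En n → ℝ≥0∞ := fun x => u x ^ (1 / 2 : ℝ) with hσ
  have hσ2 : ∀ x, σ x ^ 2 = u x := fun x => by
    rw [hσ, ← ENNReal.rpow_natCast, ← ENNReal.rpow_mul]
    norm_num
  have hσlsc : LowerSemicontinuous σ :=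
    (ENNReal.continuous_rpow_const (y := 1 / 2)).comp_lowerSemicontinuous hulsc
      (ENNReal.monotone_rpow_of_nonneg (by norm_num))
  have hρσ : ∀ x, ENNReal.ofReal (ρ x + c) ≤ σ x := fun x => by
    rw [← ENNReal.pow_le_pow_left_iff two_ne_zero, hσ2,
      ← ENNReal.ofReal_pow (add_nonneg (hρ x) hc0.le)]
    exact hfu x
  obtain ⟨v, hv, hvg⟩ := IsSlopeMinorant.exists_seq_tendsto hgc
    (fun x => (abs_le.1 (hM x)).1) (fun x => (abs_le.1 (hM x)).2) hρ hc0 hslope hσlsc hρσ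
  have hvM : ∀ k x, |v k x| ≤ M := fun k x =>
    abs_le.2 ⟨(hv k).neg_le x, ((hv k).le x).trans (abs_le.1 (hM x)).2⟩
  refine le_of_tendsto' (tendsto_entSq (μ := μ) (fun k => (hv k).continuous.measurable) hvM hvg)
    fun k => (hLS.entSq_le_of_isSlopeMinorant hC (hv k) (hvM k) ?_).trans ?_
  · simp_rw [hσ2]
    exact (hub.trans_lt ENNReal.ofReal_lt_top).ne
  · gcongr
    simp_rw [hσ2]
    exact ENNReal.toReal_le_of_le_ofReal (hI0.trans hb.le) hub

theorem neg_one_le_mul_log {t : ℝ} (ht : 0 ≤ t) : -1 ≤ t * Real.log t := by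
  rcases ht.eq_or_lt with rfl | ht
  · simp
  · have := Real.one_sub_inv_le_log_of_pos ht
    have h2 : t * (1 - t⁻¹) ≤ t * Real.log t := by gcongr
    rw [mul_sub, mul_inv_cancel₀ ht.ne'] at h2
    linarith

/-- The logarithmic Sobolev inequality extends to differentiable functions with square-integrable
value and gradient. -/
theorem LogSobolevLE.entSq_le_of_differentiable {μ : Measure (En n)} [IsProbabilityMeasure μ]
    {C : ℝ} (hLS : LogSobolevLE μ C) (hC : 0 ≤ C) {g : En n → ℝ} (hg : Differentiable ℝ g)
    (hg2 : Integrable (fun x => g x ^ 2) μ)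
    (hgrad : Integrable (fun x => ‖gradient g x‖ ^ 2) μ) :
    Integrable (fun x => g x ^ 2 * Real.log (g x ^ 2)) μ ∧
      entSq μ g ≤ C * ∫ x, ‖gradient g x‖ ^ 2 ∂μ := by
  set I := ∫ x, ‖gradient g x‖ ^ 2 ∂μ with hI
  let f : ℕ → En n → ℝ := fun k x => max (-(k : ℝ)) (min (g x) k)
  have hfc : ∀ k, Continuous (f k) := fun k =>
    continuous_const.max (hg.continuous.min continuous_const)
  have hfabs : ∀ k x, |f k x| ≤ k := fun k x =>
    abs_le.2 ⟨le_max_left _ _, max_le (by simp) (min_le_right _ _)⟩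
  have hfg : ∀ k x, |f k x| ≤ |g x| := fun k x => by
    have hk : (0 : ℝ) ≤ k := k.cast_nonneg
    refine abs_le.2 ⟨?_, max_le (by linarith [abs_nonneg (g x)])
      ((min_le_left _ _).trans (le_abs_self _))⟩
    rcases le_total (g x) k with h | h
    · exact (neg_abs_le _).trans (le_max_of_le_right (by rw [min_eq_left h]))
    · exact le_max_of_le_right (by rw [min_eq_right h]; linarith [abs_nonneg (g x)])
  have hf_eq : ∀ x, ∀ᶠ k in atTop, f k x = g x := fun x => by
    filter_upwards [eventually_ge_atTop ⌈|g x|⌉₊] with k hk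
    have := abs_le.1 (Nat.ceil_le.1 hk)
    simp only [f]
    rw [min_eq_left this.2, max_eq_right this.1]
  have hle : ∀ k, entSq μ (f k) ≤ C * I := by
    intro k
    refine hLS.entSq_le_of_slope hC (hfc k) (hfabs k) (fun x => norm_nonneg _)
      (measurable_norm_gradient g) hgrad fun z η hη => ?_
    have h1 := (hg z).hasFDerivAt.isLittleO.def hη
    filter_upwards [h1] with y hy
    have h2 : |g z - g y| ≤ (‖gradient g z‖ + η) * dist y z := by
      rw [norm_gradient_eq, dist_eq_norm, ← Real.norm_eq_abs, ← norm_neg]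
      calc ‖-(g z - g y)‖ = ‖(g y - g z - fderiv ℝ g z (y - z)) + fderiv ℝ g z (y - z)‖ := by
            congr 1; ring
        _ ≤ η * ‖y - z‖ + ‖fderiv ℝ g z‖ * ‖y - z‖ :=
            (norm_add_le _ _).trans (add_le_add hy (ContinuousLinearMap.le_opNorm _ _))
        _ = _ := by ring
    have h3 : |f k z - f k y| ≤ |g z - g y| := by
      have := ((LipschitzWith.id.min_const (k : ℝ)).const_max (-(k : ℝ))).dist_le_mul (g z) (g y)
      simpa [Real.dist_eq, f] using this
    linarith [le_abs_self (f k z - f k y)]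
  have h2 : Tendsto (fun k => ∫ x, (f k x) ^ 2 ∂μ) atTop (𝓝 (∫ x, (g x) ^ 2 ∂μ)) := by
    refine tendsto_integral_of_dominated_convergence (fun x => g x ^ 2)
      (fun k => ((hfc k).pow 2).aestronglyMeasurable) hg2
      (fun k => Eventually.of_forall fun x => ?_) (Eventually.of_forall fun x => ?_)
    · rw [Real.norm_of_nonneg (sq_nonneg _)]
      exact sq_le_sq.2 (hfg k x)
    · exact tendsto_const_nhds.congr' ((hf_eq x).mono fun k hk => by simp only [hk])
  set J := C * I + (∫ x, (g x) ^ 2 ∂μ) * Real.log (∫ x, (g x) ^ 2 ∂μ) with hJ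
  have h3 : Tendsto (fun k => C * I + (∫ x, (f k x) ^ 2 ∂μ) * Real.log (∫ x, (f k x) ^ 2 ∂μ) + 1)
      atTop (𝓝 (J + 1)) :=
    (((Real.continuous_mul_log.tendsto _).comp h2).const_add _).add_const _
  have hcont : ∀ h : En n → ℝ, Continuous h →
      Continuous fun x => h x ^ 2 * Real.log (h x ^ 2) := fun h hh =>
    Real.continuous_mul_log.comp (hh.pow 2)
  have hpos : ∀ t : ℝ, 0 ≤ t ^ 2 * Real.log (t ^ 2) + 1 := fun t => by
    linarith [neg_one_le_mul_log (sq_nonneg t)]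
  have hfatou : ∫⁻ x, ENNReal.ofReal (g x ^ 2 * Real.log (g x ^ 2) + 1) ∂μ
      ≤ ENNReal.ofReal (J + 1) := by
    calc ∫⁻ x, ENNReal.ofReal (g x ^ 2 * Real.log (g x ^ 2) + 1) ∂μ
        ≤ ∫⁻ x, liminf (fun k => ENNReal.ofReal (f k x ^ 2 * Real.log (f k x ^ 2) + 1)) atTop
            ∂μ := by
          refine lintegral_mono fun x => ge_of_eq (Tendsto.liminf_eq ?_)
          exact tendsto_const_nhds.congr' ((hf_eq x).mono fun k hk => by simp only [hk])
      _ ≤ liminf (fun k => ∫⁻ x, ENNReal.ofReal (f k x ^ 2 * Real.log (f k x ^ 2) + 1) ∂μ) atTop :=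
          lintegral_liminf_le fun k =>
            ((hcont _ (hfc k)).add continuous_const).measurable.ennreal_ofReal
      _ ≤ liminf (fun k => ENNReal.ofReal
            (C * I + (∫ x, (f k x) ^ 2 ∂μ) * Real.log (∫ x, (f k x) ^ 2 ∂μ) + 1)) atTop := by
          refine liminf_le_liminf (Eventually.of_forall fun k => ?_)
          obtain ⟨B, hB⟩ := exists_abs_sq_mul_log_le k
          have hfi : Integrable (fun x => f k x ^ 2 * Real.log (f k x ^ 2)) μ :=
            (integrable_const B).mono' (hcont _ (hfc k)).aestronglyMeasurable
              (Eventually.of_forall fun x => hB _ (hfabs k x))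
          have hint1 : Integrable (fun x => f k x ^ 2 * Real.log (f k x ^ 2) + 1) μ :=
            hfi.add (integrable_const 1)
          rw [← ofReal_integral_eq_lintegral_ofReal hint1
            (Eventually.of_forall fun x => hpos _), integral_add hfi (integrable_const 1)]
          refine ENNReal.ofReal_le_ofReal ?_
          have := hle k
          simp only [entSq] at this
          simp only [integral_const, probReal_univ, smul_eq_mul, one_mul]
          linarith
      _ = ENNReal.ofReal (J + 1) := (ENNReal.tendsto_ofReal h3).liminf_eq
  have hint1 : Integrable (fun x => g x ^ 2 * Real.log (g x ^ 2) + 1) μ := by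
    refine ⟨((hcont g hg.continuous).add continuous_const).aestronglyMeasurable, ?_⟩
    rw [hasFiniteIntegral_iff_ofReal (Eventually.of_forall fun x => hpos _)]
    exact hfatou.trans_lt ENNReal.ofReal_lt_top
  have hfi : Integrable (fun x => g x ^ 2 * Real.log (g x ^ 2)) μ := by
    refine (hint1.sub (integrable_const (1 : ℝ))).congr (Eventually.of_forall fun x => ?_)
    exact add_sub_cancel_right _ _
  refine ⟨hfi, ?_⟩
  have hJ0 : 0 ≤ J + 1 := by
    refine ge_of_tendsto' h3 fun k => ?_
    have h4 := hle k
    have h5 : 0 ≤ ∫ x, (f k x ^ 2 * Real.log (f k x ^ 2) + 1) ∂μ := integral_nonneg fun x => hpos _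
    obtain ⟨B, hB⟩ := exists_abs_sq_mul_log_le k
    rw [integral_add ((integrable_const B).mono' (hcont _ (hfc k)).aestronglyMeasurable
      (Eventually.of_forall fun x => hB _ (hfabs k x))) (integrable_const 1)] at h5
    simp only [entSq] at h4
    simp only [integral_const, probReal_univ, smul_eq_mul, one_mul] at h5
    linarith
  rw [← ofReal_integral_eq_lintegral_ofReal hint1 (Eventually.of_forall fun x => hpos _),
    ENNReal.ofReal_le_ofReal_iff hJ0, integral_add hfi (integrable_const 1)] at hfatou
  simp only [integral_const, probReal_univ, smul_eq_mul, one_mul] at hfatou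
  simp only [entSq]
  linarith

end Extension

section Entropy
open Filter Topology

theorem mul_log_one_add_div_six_le {y : ℝ} (hy : 0 ≤ y) :
    y * log (1 + y / 6) + y ≤ (1 + y) * log (1 + y) := by
  have hd : ∀ x ∈ Ioi (0 : ℝ), HasDerivAt
      (fun x : ℝ => (1 + x) * log (1 + x) - (x * log (1 + x / 6) + x))
      (log (1 + x) - log (1 + x / 6) - x / (6 + x)) x := by
    intro x hx
    have hx : 0 < x := hx
    have h1 : HasDerivAt (fun x : ℝ => 1 + x) 1 x := (hasDerivAt_id x).const_add 1
    have h2 : HasDerivAt (fun x : ℝ => 1 + x / 6) (1 / 6) x :=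
      ((hasDerivAt_id x).div_const 6).const_add 1
    have h3 := (h1.mul (h1.log (by positivity))).sub
      (((hasDerivAt_id x).mul (h2.log (by positivity))).add (hasDerivAt_id x))
    refine h3.congr_deriv ?_
    simp only [id]
    field_simp
    ring
  have hmono : MonotoneOn (fun x : ℝ => (1 + x) * log (1 + x) - (x * log (1 + x / 6) + x))
      (Ici 0) := by
    refine monotoneOn_of_deriv_nonneg (convex_Ici 0) ?_ ?_ ?_
    · refine ContinuousOn.sub (ContinuousOn.mul (by fun_prop) (ContinuousOn.log (by fun_prop) ?_))
        (ContinuousOn.add (ContinuousOn.mul (by fun_prop) (ContinuousOn.log (by fun_prop) ?_))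
          (by fun_prop))
      all_goals
        intro x hx
        have : (0 : ℝ) ≤ x := hx
        positivity
    · rw [interior_Ici]
      exact fun x hx => (hd x hx).differentiableAt.differentiableWithinAt
    · rw [interior_Ici]
      intro x hx
      rw [(hd x hx).deriv]
      have hx : 0 < x := hx
      have e : log (1 + x) - log (1 + x / 6) = log (6 * (1 + x) / (6 + x)) := by
        rw [← log_div (by positivity) (by positivity)]
        congr 1
        field_simp
      rw [e]
      rcases le_total x 24 with h | h
      · have h4 := one_sub_inv_le_log_of_pos (x := 6 * (1 + x) / (6 + x)) (by positivity)
        have : x / (6 + x) ≤ 1 - (6 * (1 + x) / (6 + x))⁻¹ := by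
          rw [inv_div, div_le_iff₀ (by positivity), sub_mul, div_mul_eq_mul_div,
            le_sub_comm, div_le_iff₀ (by positivity)]
          nlinarith
        linarith
      · have h5 : (1 : ℝ) ≤ log (6 * (1 + x) / (6 + x)) := by
          rw [le_log_iff_exp_le (by positivity)]
          have := exp_one_lt_d9
          rw [le_div_iff₀ (by positivity)]
          nlinarith
        have h6 : x / (6 + x) ≤ 1 := by
          rw [div_le_one (by positivity)]; linarith
        linarith
  have := hmono (by simp) (show y ∈ Ici 0 from hy) hy
  simp at this
  linarith
theorem one_add_sq_mul_log_le_neg {w : ℝ} (hw : 0 ≤ w) :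
    (1 + w) ^ 2 * log (6 / (w ^ 2 - 2 * w + 3)) + w ^ 2 * log (w ^ 2) ≤ 1 + 4 * w + 3 * w ^ 2 := by
  have hQ : 2 ≤ w ^ 2 - 2 * w + 3 := by nlinarith [sq_nonneg (w - 1)]
  have hQ0 : 0 < w ^ 2 - 2 * w + 3 := by linarith
  have he := exp_one_gt_d9
  have hlog3 : log 3 ≤ 1.15 := by
    rw [log_le_iff_le_exp (by norm_num), show (1.15 : ℝ) = 1 + 0.15 by norm_num, exp_add]
    nlinarith [add_one_le_exp (0.15 : ℝ)]
  have h1 : w ^ 2 * log (6 / (w ^ 2 - 2 * w + 3)) + w ^ 2 * log (w ^ 2) ≤ 2.3 * w ^ 2 := by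
    rcases hw.eq_or_lt with rfl | hw
    · simp
    rw [← mul_add, ← log_mul (by positivity) (by positivity), mul_comm (2.3 : ℝ)]
    refine mul_le_mul_of_nonneg_left ?_ (sq_nonneg w)
    calc log (6 / (w ^ 2 - 2 * w + 3) * w ^ 2) ≤ log (3 ^ 2) := by
          refine log_le_log (by positivity) ?_
          rw [div_mul_eq_mul_div, div_le_iff₀ hQ0]
          nlinarith [sq_nonneg (w - 3)]
      _ ≤ 2.3 := by rw [log_pow]; push_cast; linarith
  have h2 : (1 + 2 * w) * log (6 / (w ^ 2 - 2 * w + 3)) ≤ 1 + 4 * w := by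
    rcases le_total w 0.1 with h | h
    · have : log (6 / (w ^ 2 - 2 * w + 3)) ≤ 1 := by
        rw [log_le_iff_le_exp (by positivity), div_le_iff₀ hQ0]
        nlinarith
      nlinarith
    · have : log (6 / (w ^ 2 - 2 * w + 3)) ≤ log 3 := by
        refine log_le_log (by positivity) ?_
        rw [div_le_iff₀ hQ0]
        linarith
      nlinarith
  nlinarith [sq_nonneg w]

theorem one_add_sq_mul_log_le_pos {k u : ℝ} (hk : 0 < k) (hu : -1 < u) :
    (1 + u) ^ 2 * log ((1 + u) ^ 2) ≤
      2 * u + u ^ 2 * (2 - log k) + k * (u ^ 2 + 2 * u ^ 3 / 3 + u ^ 4 / 6) := by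
  have hpos : ∀ s ∈ Ioi (-1 : ℝ), 0 < 1 + s := fun s hs => by
    have : (-1 : ℝ) < s := hs
    linarith
  have hlog : ∀ s ∈ Ioi (-1 : ℝ), HasDerivAt (fun s => log (1 + s)) (1 / (1 + s)) s :=
    fun s hs => ((hasDerivAt_id s).const_add 1).log (hpos s hs).ne'
  have h1 : ∀ s : ℝ, HasDerivAt (fun s : ℝ => 1 + s) 1 s := fun s => (hasDerivAt_id s).const_add 1
  have hpow : ∀ (m : ℕ) (s : ℝ), HasDerivAt (fun s : ℝ => s ^ m) (m * s ^ (m - 1)) s :=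
    fun m s => hasDerivAt_pow m s
  have hE : ∀ s ∈ Ioi (-1 : ℝ), HasDerivAt (fun s : ℝ => 2 * s + s ^ 2 * (2 - log k)
      + k * (s ^ 2 + 2 * s ^ 3 / 3 + s ^ 4 / 6) - 2 * ((1 + s) ^ 2 * log (1 + s)))
      (2 + 2 * s * (2 - log k) + k * (2 * s + 2 * s ^ 2 + 2 * s ^ 3 / 3)
        - 4 * ((1 + s) * log (1 + s)) - 2 * (1 + s)) s := by
    intro s hs
    have h := (((hasDerivAt_id s).const_mul 2).add ((hpow 2 s).mul_const (2 - log k))).add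
      ((((hpow 2 s).add (((hpow 3 s).const_mul 2).div_const 3)).add
        ((hpow 4 s).div_const 6)).const_mul k) |>.sub
      ((((h1 s).pow 2).mul (hlog s hs)).const_mul 2)
    refine h.congr_deriv ?_
    have := hpos s hs
    rw [Pi.pow_apply]
    field_simp
    push_cast
    ring
  have hE' : ∀ s ∈ Ioi (-1 : ℝ), HasDerivAt (fun s : ℝ => 2 + 2 * s * (2 - log k)
      + k * (2 * s + 2 * s ^ 2 + 2 * s ^ 3 / 3) - 4 * ((1 + s) * log (1 + s)) - 2 * (1 + s))
      (2 * (k * (1 + s) ^ 2 - 1 - log (k * (1 + s) ^ 2))) s := by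
    intro s hs
    have h := ((((hasDerivAt_id s).const_mul 2).mul_const (2 - log k)).const_add 2).add
      (((((hasDerivAt_id s).const_mul 2).add ((hpow 2 s).const_mul 2)).add
        (((hpow 3 s).const_mul 2).div_const 3)).const_mul k) |>.sub
      (((h1 s).mul (hlog s hs)).const_mul 4) |>.sub ((h1 s).const_mul 2)
    refine h.congr_deriv ?_
    have := hpos s hs
    rw [log_mul hk.ne' (by positivity), log_pow]
    field_simp
    push_cast
    ring
  have hmono : MonotoneOn (fun s : ℝ => 2 + 2 * s * (2 - log k)
      + k * (2 * s + 2 * s ^ 2 + 2 * s ^ 3 / 3) - 4 * ((1 + s) * log (1 + s)) - 2 * (1 + s))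
      (Ioi (-1)) := by
    refine monotoneOn_of_deriv_nonneg (convex_Ioi _)
      (fun s hs => (hE' s hs).continuousAt.continuousWithinAt) ?_ ?_ <;> rw [interior_Ioi]
    · exact fun s hs => (hE' s hs).differentiableAt.differentiableWithinAt
    · intro s hs
      rw [(hE' s hs).deriv]
      have := hpos s hs
      have := log_le_sub_one_of_pos (x := k * (1 + s) ^ 2) (by positivity)
      linarith
  have hconv := MonotoneOn.convexOn_of_deriv (convex_Ioi (-1 : ℝ))
    (fun s hs => (hE s hs).continuousAt.continuousWithinAt)
    (by rw [interior_Ioi]; exact fun s hs => (hE s hs).differentiableAt.differentiableWithinAt)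
    (by rw [interior_Ioi]; exact hmono.congr fun s hs => (hE s hs).deriv.symm)
  have h0 : (0 : ℝ) ∈ Ioi (-1 : ℝ) := by simp
  have hmin := hconv.isMinOn_of_rightDeriv_eq_zero (x := 0) (by rw [interior_Ioi]; exact h0) (by
    rw [((hE 0 h0).hasDerivWithinAt.derivWithin (uniqueDiffWithinAt_Ioi 0))]; simp)
  have := hmin (show u ∈ Ioi (-1 : ℝ) from hu)
  simp at this
  rw [log_pow]
  push_cast
  linarith

theorem one_add_sq_mul_log_le {κ : ℝ} (hκ : 0 < κ) (u : ℝ) :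
    (1 + u) ^ 2 * log ((1 + u) ^ 2) ≤
      2 * u + u ^ 2 * log (u ^ 2) - u ^ 2 * log κ + 2 * u ^ 2 + κ * (1 + 2 * u / 3 + u ^ 2 / 6) := by
  rcases eq_or_ne u 0 with rfl | hu0
  · simpa using hκ.le
  have hu2 : 0 < u ^ 2 := by positivity
  have hlogk : log (κ / u ^ 2) = log κ - log (u ^ 2) := log_div hκ.ne' hu2.ne'
  have hk : 0 < κ / u ^ 2 := by positivity
  rcases lt_or_ge (-1) u with hu | hu
  · have h := one_add_sq_mul_log_le_pos hk hu
    have e : κ / u ^ 2 * (u ^ 2 + 2 * u ^ 3 / 3 + u ^ 4 / 6)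
        = κ * (1 + 2 * u / 3 + u ^ 2 / 6) := by
      field_simp
    rw [e, hlogk] at h
    linarith
  · have h := one_add_sq_mul_log_le_neg (w := -1 - u) (by linarith)
    have hP : 0 < 1 + 2 * u / 3 + u ^ 2 / 6 := by nlinarith [sq_nonneg (u + 2)]
    have e1 : 6 / ((-1 - u) ^ 2 - 2 * (-1 - u) + 3) = (1 + 2 * u / 3 + u ^ 2 / 6)⁻¹ := by
      rw [← one_div, div_eq_div_iff (by nlinarith) hP.ne']
      ring
    rw [e1, log_inv, show (1 + (-1 - u)) ^ 2 = u ^ 2 by ring,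
      show (-1 - u) ^ 2 = (1 + u) ^ 2 by ring] at h
    have h2 := log_le_sub_one_of_pos (mul_pos hk hP)
    rw [log_mul hk.ne' hP.ne', hlogk] at h2
    have h3 := mul_le_mul_of_nonneg_left h2 hu2.le
    have e : u ^ 2 * (κ / u ^ 2 * (1 + 2 * u / 3 + u ^ 2 / 6) - 1)
        = κ * (1 + 2 * u / 3 + u ^ 2 / 6) - u ^ 2 := by
      field_simp
    rw [e] at h3
    nlinarith

theorem integrable_of_bdd {α : Type*} [MeasurableSpace α] {ν : Measure α} [IsFiniteMeasure ν]
    {f : α → ℝ} (hf : Measurable f) {M : ℝ} (hM : ∀ x, |f x| ≤ M) : Integrable f ν :=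
  (integrable_const M).mono' hf.aestronglyMeasurable (Eventually.of_forall hM)

theorem integrable_sq_of_bdd {α : Type*} [MeasurableSpace α] {ν : Measure α} [IsFiniteMeasure ν]
    {f : α → ℝ} (hf : Measurable f) {M : ℝ} (hM : ∀ x, |f x| ≤ M) :
    Integrable (fun x => f x ^ 2) ν :=
  integrable_of_bdd (hf.pow_const 2) (M := M ^ 2) fun x => by
    rw [abs_pow]
    exact pow_le_pow_left₀ (abs_nonneg _) (hM x) 2

theorem integrable_sq_mul_log_of_bdd {α : Type*} [MeasurableSpace α] {ν : Measure α}
    [IsFiniteMeasure ν] {f : α → ℝ} (hf : Measurable f) {M : ℝ} (hM : ∀ x, |f x| ≤ M) :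
    Integrable (fun x => f x ^ 2 * log (f x ^ 2)) ν := by
  obtain ⟨B, hB⟩ := exists_abs_sq_mul_log_le M
  exact integrable_of_bdd (Real.continuous_mul_log.measurable.comp (hf.pow_const 2))
    fun x => hB _ (hM x)

theorem entSq_const_mul {α : Type*} [MeasurableSpace α] {ν : Measure α} [IsFiniteMeasure ν]
    {f : α → ℝ} (hf : Measurable f) {M : ℝ} (hM : ∀ x, |f x| ≤ M) {c : ℝ} (hc : c ≠ 0) :
    entSq ν (fun x => c * f x) = c ^ 2 * entSq ν f := by
  have key : ∀ t : ℝ, c ^ 2 * t * log (c ^ 2 * t)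
      = c ^ 2 * log (c ^ 2) * t + c ^ 2 * (t * log t) := fun t => by
    rcases eq_or_ne t 0 with rfl | ht
    · simp
    · rw [log_mul (by positivity) ht]
      ring
  simp only [entSq, mul_pow, key, integral_const_mul]
  rw [integral_add ((integrable_sq_of_bdd hf hM).const_mul _)
    ((integrable_sq_mul_log_of_bdd hf hM).const_mul _), integral_const_mul, integral_const_mul]
  ring

theorem entSq_one_add_le {α : Type*} [MeasurableSpace α] {ν : Measure α} [IsProbabilityMeasure ν]
    {u : α → ℝ} (hu : Measurable u) {M : ℝ} (hM : ∀ x, |u x| ≤ M) (hu0 : ∫ x, u x ∂ν = 0) :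
    entSq ν (fun x => 1 + u x) ≤ entSq ν u + 2 * ∫ x, u x ^ 2 ∂ν := by
  have hi := integrable_of_bdd (ν := ν) hu hM
  have hi2 := integrable_sq_of_bdd (ν := ν) hu hM
  have hil := integrable_sq_mul_log_of_bdd (ν := ν) hu hM
  have hil1 : Integrable (fun x => (1 + u x) ^ 2 * log ((1 + u x) ^ 2)) ν :=
    integrable_sq_mul_log_of_bdd (hu.const_add 1) (M := 1 + M) fun x =>
      (abs_add_le _ _).trans (by rw [abs_one]; linarith [hM x])
  simp only [entSq]
  set y := ∫ x, u x ^ 2 ∂ν with hy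
  have hy0 : 0 ≤ y := integral_nonneg fun x => sq_nonneg _
  have h1 : ∫ x, (1 + u x) ^ 2 ∂ν = 1 + y := by
    have : ∀ x, (1 + u x) ^ 2 = (1 + 2 * u x) + u x ^ 2 := fun x => by ring
    simp only [this]
    rw [integral_add ((integrable_const 1).fun_add (hi.const_mul 2)) hi2,
      integral_add (integrable_const 1) (hi.const_mul 2), integral_const_mul, hu0]
    simp [hy]
  have hmain : ∀ κ : ℝ, 0 < κ → ∫ x, (1 + u x) ^ 2 * log ((1 + u x) ^ 2) ∂ν ≤
      ∫ x, u x ^ 2 * log (u x ^ 2) ∂ν + (2 - log κ + κ / 6) * y + κ := by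
    intro κ hκ
    have e : ∫ x, ((u x ^ 2 * log (u x ^ 2) + (2 - log κ + κ / 6) * u x ^ 2)
        + ((2 + 2 * κ / 3) * u x + κ)) ∂ν
        = ∫ x, u x ^ 2 * log (u x ^ 2) ∂ν + (2 - log κ + κ / 6) * y + κ := by
      rw [integral_add (hil.fun_add (hi2.const_mul _)) ((hi.const_mul _).fun_add (integrable_const κ)),
        integral_add hil (hi2.const_mul _), integral_add (hi.const_mul _) (integrable_const κ),
        integral_const_mul, integral_const_mul, hu0]
      simp [hy]
    rw [← e]
    refine integral_mono hil1 ((hil.add (hi2.const_mul _)).add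
      ((hi.const_mul _).add (integrable_const κ))) fun x => ?_
    have := one_add_sq_mul_log_le hκ (u x)
    dsimp only
    linarith
  rw [h1]
  rcases hy0.eq_or_lt with h0 | h0
  · rw [← h0]
    simp only [mul_zero, zero_mul, add_zero, sub_zero, log_one]
    refine le_of_forall_pos_le_add fun κ hκ => ?_
    have := hmain κ hκ
    rwa [← h0, mul_zero, add_zero] at this
  · have h2 := hmain (y / (1 + y / 6)) (by positivity)
    rw [log_div h0.ne' (by positivity)] at h2
    have h3 := mul_log_one_add_div_six_le hy0
    have e : y / (1 + y / 6) / 6 * y + y / (1 + y / 6) = y := by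
      field_simp
      ring
    nlinarith

/-- The Rothaus lemma. -/
theorem entSq_le_entSq_sub_integral_add {α : Type*} [MeasurableSpace α] {ν : Measure α}
    [IsProbabilityMeasure ν] {f : α → ℝ} (hf : Measurable f) {M : ℝ} (hM : ∀ x, |f x| ≤ M) :
    entSq ν f ≤ entSq ν (fun x => f x - ∫ y, f y ∂ν) +
      2 * ∫ x, (f x - ∫ y, f y ∂ν) ^ 2 ∂ν := by
  set m := ∫ y, f y ∂ν with hm
  rcases eq_or_ne m 0 with h0 | h0
  · simp only [h0, sub_zero]
    linarith [(integral_nonneg fun x => sq_nonneg (f x) : 0 ≤ ∫ x, f x ^ 2 ∂ν)]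
  have hu : Measurable fun x => m⁻¹ * (f x - m) := (hf.sub_const m).const_mul _
  have huM : ∀ x, |m⁻¹ * (f x - m)| ≤ |m⁻¹| * (M + |m|) := fun x => by
    rw [abs_mul]
    exact mul_le_mul_of_nonneg_left ((abs_sub _ _).trans (by linarith [hM x])) (abs_nonneg _)
  have hu0 : ∫ x, m⁻¹ * (f x - m) ∂ν = 0 := by
    rw [integral_const_mul, integral_sub (integrable_of_bdd hf hM) (integrable_const m)]
    simp [hm]
  have h := entSq_one_add_le hu huM hu0
  have e1 : ∀ x, m * (1 + m⁻¹ * (f x - m)) = f x := fun x => by field_simp; ring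
  have e2 : ∀ x, m * (m⁻¹ * (f x - m)) = f x - m := fun x => by field_simp
  have h1 := entSq_const_mul (ν := ν) (hu.const_add 1) (M := 1 + |m⁻¹| * (M + |m|))
    (fun x => (abs_add_le _ _).trans (by rw [abs_one]; linarith [huM x])) h0
  have h2 := entSq_const_mul (ν := ν) hu huM h0
  have h3 : ∫ x, (f x - m) ^ 2 ∂ν = m ^ 2 * ∫ x, (m⁻¹ * (f x - m)) ^ 2 ∂ν := by
    rw [← integral_const_mul]
    exact integral_congr_ae (Eventually.of_forall fun x => by simp only; rw [← mul_pow, e2])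
  simp only [e1] at h1
  simp only [e2] at h2
  rw [h1, h2, h3]
  nlinarith [mul_le_mul_of_nonneg_left h (sq_nonneg m)]

/-- The entropic (Donsker-Varadhan) inequality. -/
theorem integral_sq_mul_le_entSq_add {α : Type*} [MeasurableSpace α] {ν : Measure α}
    [IsProbabilityMeasure ν] {f φ : α → ℝ} (hf : Measurable f) {M : ℝ} (hM : ∀ x, |f x| ≤ M)
    (hφ : Integrable (fun x => exp (φ x)) ν) (hfφ : Integrable (fun x => f x ^ 2 * φ x) ν) :
    ∫ x, f x ^ 2 * φ x ∂ν ≤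
      entSq ν f + (∫ x, f x ^ 2 ∂ν) * log (∫ x, exp (φ x) ∂ν) := by
  have hi2 := integrable_sq_of_bdd (ν := ν) hf hM
  have hil := integrable_sq_mul_log_of_bdd (ν := ν) hf hM
  have hZ : 0 < ∫ x, exp (φ x) ∂ν := integral_exp_pos hφ
  simp only [entSq]
  set Z := ∫ x, exp (φ x) ∂ν with hZdef
  set m := ∫ x, f x ^ 2 ∂ν with hm
  rcases (integral_nonneg fun x => sq_nonneg (f x) : 0 ≤ m).eq_or_lt with h0 | h0
  · have h := (integral_eq_zero_iff_of_nonneg (fun x => sq_nonneg (f x)) hi2).1 h0.symm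
    have e1 : ∫ x, f x ^ 2 * φ x ∂ν = 0 := integral_eq_zero_of_ae <| h.mono fun x hx => by
      simp only [Pi.zero_apply] at hx ⊢; rw [hx, zero_mul]
    have e2 : ∫ x, f x ^ 2 * log (f x ^ 2) ∂ν = 0 :=
      integral_eq_zero_of_ae <| h.mono fun x hx => by
        simp only [Pi.zero_apply] at hx ⊢; rw [hx, zero_mul]
    rw [e1, e2, show m = 0 from h0.symm]
    simp
  · have hpt : ∀ x, f x ^ 2 * φ x ≤
        (f x ^ 2 * log (f x ^ 2) + (log Z - log m - 1) * f x ^ 2) + m / Z * exp (φ x) := by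
      intro x
      rcases (sq_nonneg (f x)).eq_or_lt with h | h
      · rw [← h]
        simp only [zero_mul, mul_zero, zero_add]
        positivity
      · have h1 := log_le_sub_one_of_pos (x := m / Z * exp (φ x) / f x ^ 2) (by positivity)
        rw [log_div (by positivity) h.ne', log_mul (by positivity) (by positivity),
          log_div h0.ne' hZ.ne', log_exp] at h1
        have h2 := mul_le_mul_of_nonneg_left h1 h.le
        rw [mul_sub (f x ^ 2) (_ / _), mul_div_cancel₀ _ h.ne'] at h2
        linarith
    have h := integral_mono hfφ ((hil.add (hi2.const_mul _)).add (hφ.const_mul _)) hpt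
    have e : ∫ x, ((f x ^ 2 * log (f x ^ 2) + (log Z - log m - 1) * f x ^ 2)
        + m / Z * exp (φ x)) ∂ν
        = ∫ x, f x ^ 2 * log (f x ^ 2) ∂ν + (log Z - log m - 1) * m + m := by
      rw [integral_add (hil.fun_add (hi2.const_mul _)) (hφ.const_mul _),
        integral_add hil (hi2.const_mul _), integral_const_mul, integral_const_mul, ← hm, ← hZdef,
        div_mul_cancel₀ _ hZ.ne']
    simp only [Pi.add_apply] at h
    rw [e] at h
    linarith

end Entropy

section Perturbation

variable {n : ℕ} {μ : Measure (En n)} {F : En n → ℝ}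

theorem perturb_eq_withDensity (hnorm : ∫ x, exp (-F x) ∂μ = 1) :
    perturb μ F = μ.withDensity fun x => ENNReal.ofReal (exp (-F x)) := by
  rw [perturb, hnorm]
  simp

theorem integrable_exp_neg (hnorm : ∫ x, exp (-F x) ∂μ = 1) :
    Integrable (fun x => exp (-F x)) μ :=
  not_imp_comm.1 integral_undef (by rw [hnorm]; exact one_ne_zero)

theorem isProbabilityMeasure_perturb (hnorm : ∫ x, exp (-F x) ∂μ = 1) :
    IsProbabilityMeasure (perturb μ F) := by
  rw [perturb_eq_withDensity hnorm]
  refine ⟨?_⟩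
  rw [withDensity_apply _ MeasurableSet.univ, Measure.restrict_univ,
    ← ofReal_integral_eq_lintegral_ofReal (integrable_exp_neg hnorm)
      (Filter.Eventually.of_forall fun x => (exp_pos _).le), hnorm, ENNReal.ofReal_one]

theorem integrable_perturb_iff (hF : Measurable F) (hnorm : ∫ x, exp (-F x) ∂μ = 1)
    {φ : En n → ℝ} :
    Integrable φ (perturb μ F) ↔ Integrable (fun x => exp (-F x) * φ x) μ := by
  rw [perturb_eq_withDensity hnorm,
    integrable_withDensity_iff_integrable_smul' (by fun_prop) (by simp)]
  simp [ENNReal.toReal_ofReal (exp_pos _).le]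

theorem integral_perturb (hF : Measurable F) (hnorm : ∫ x, exp (-F x) ∂μ = 1) (φ : En n → ℝ) :
    ∫ x, φ x ∂(perturb μ F) = ∫ x, exp (-F x) * φ x ∂μ := by
  rw [perturb_eq_withDensity hnorm,
    integral_withDensity_eq_integral_toReal_smul (by fun_prop) (by simp)]
  simp [ENNReal.toReal_ofReal (exp_pos _).le]

theorem norm_gradient_mul_exp_sq_le {h : En n → ℝ} (hh : Differentiable ℝ h)
    (hF : Differentiable ℝ F) {θ : ℝ} (hθ : 0 < θ) (x : En n) :
    ‖gradient (fun y => h y * exp (-F y / 2)) x‖ ^ 2 ≤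
      exp (-F x) * ((1 + θ⁻¹) * ‖gradient h x‖ ^ 2
        + (1 + θ) / 4 * (h x ^ 2 * ‖gradient F x‖ ^ 2)) := by
  have hd : HasFDerivAt (fun y => h y * exp (-F y / 2))
      (exp (-F x / 2) • (fderiv ℝ h x - (h x / 2) • fderiv ℝ F x)) x := by
    have h1 : HasFDerivAt (fun y => -F y / 2) ((-(1 / 2) : ℝ) • fderiv ℝ F x) x := by
      refine ((hF x).hasFDerivAt.const_mul (-(1 / 2) : ℝ)).congr_of_eventuallyEq
        (Filter.Eventually.of_forall fun y => ?_)
      ring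
    refine ((hh x).hasFDerivAt.mul h1.exp).congr_fderiv ?_
    module
  rw [norm_gradient_eq, norm_gradient_eq, norm_gradient_eq, hd.fderiv, norm_smul, mul_pow,
    norm_of_nonneg (exp_pos _).le, ← exp_nat_mul]
  have e : ((2 : ℕ) : ℝ) * (-F x / 2) = -F x := by push_cast; ring
  rw [e]
  refine mul_le_mul_of_nonneg_left ?_ (exp_pos _).le
  have h2 : ‖fderiv ℝ h x - (h x / 2) • fderiv ℝ F x‖
      ≤ ‖fderiv ℝ h x‖ + |h x| / 2 * ‖fderiv ℝ F x‖ := by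
    refine (norm_sub_le _ _).trans_eq ?_
    rw [norm_smul, norm_div, norm_eq_abs, norm_ofNat]
  set a := ‖fderiv ℝ h x‖
  set b := ‖fderiv ℝ F x‖
  calc ‖fderiv ℝ h x - (h x / 2) • fderiv ℝ F x‖ ^ 2
      ≤ (a + |h x| / 2 * b) ^ 2 := pow_le_pow_left₀ (norm_nonneg _) h2 2
    _ ≤ (1 + θ⁻¹) * a ^ 2 + (1 + θ) / 4 * (|h x| ^ 2 * b ^ 2) := by
        have h3 : 0 ≤ θ⁻¹ * (a - θ * (|h x| / 2 * b)) ^ 2 := by positivity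
        have h4 : θ⁻¹ * (a - θ * (|h x| / 2 * b)) ^ 2
            = θ⁻¹ * a ^ 2 - a * (|h x| * b) + θ / 4 * (|h x| ^ 2 * b ^ 2) := by
          field_simp
          ring
        rw [h4] at h3
        linarith
    _ = _ := by rw [sq_abs]

/-- A logarithmic Sobolev inequality for `μ` gives a defective one for the perturbed measure. -/
theorem LogSobolevLE.entSq_perturb_le [IsProbabilityMeasure μ] {C : ℝ} (hLS : LogSobolevLE μ C)
    (hC : 0 ≤ C) (hF : Differentiable ℝ F) (hnorm : ∫ x, exp (-F x) ∂μ = 1)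
    (hFgrad : Integrable (fun x => ‖gradient F x‖ ^ 2) (perturb μ F)) {θ : ℝ} (hθ : 0 < θ)
    {h : En n → ℝ} (hh : Differentiable ℝ h) {M : ℝ} (hM : ∀ x, |h x| ≤ M)
    {L : ℝ} (hL : ∀ x, ‖gradient h x‖ ≤ L) :
    Integrable (fun x => h x ^ 2 * ‖gradient F x‖ ^ 2) (perturb μ F) ∧
      Integrable (fun x => h x ^ 2 * F x) (perturb μ F) ∧
      entSq (perturb μ F) h ≤ C * ((1 + θ⁻¹) * ∫ x, ‖gradient h x‖ ^ 2 ∂(perturb μ F)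
        + (1 + θ) / 4 * ∫ x, h x ^ 2 * ‖gradient F x‖ ^ 2 ∂(perturb μ F))
        + ∫ x, h x ^ 2 * F x ∂(perturb μ F) := by
  have := isProbabilityMeasure_perturb hnorm
  have hFm : Measurable F := hF.continuous.measurable
  have hhm : Measurable h := hh.continuous.measurable
  have hi2 := integrable_sq_of_bdd (ν := perturb μ F) hhm hM
  have hil := integrable_sq_mul_log_of_bdd (ν := perturb μ F) hhm hM
  have hig : Integrable (fun x => ‖gradient h x‖ ^ 2) (perturb μ F) :=
    integrable_sq_of_bdd (measurable_norm_gradient h) (M := L) fun x => by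
      rw [abs_norm]; exact hL x
  have hihF : Integrable (fun x => h x ^ 2 * ‖gradient F x‖ ^ 2) (perturb μ F) :=
    hFgrad.bdd_mul (c := M ^ 2) (hhm.pow_const 2).aestronglyMeasurable
      (Filter.Eventually.of_forall fun x => by
        rw [norm_pow]
        exact pow_le_pow_left₀ (norm_nonneg _) (hM x) 2)
  have hR := (hig.const_mul (1 + θ⁻¹)).fun_add (hihF.const_mul ((1 + θ) / 4))
  have hgd : Differentiable ℝ fun x => h x * exp (-F x / 2) := by fun_prop
  have hgsq : ∀ x, (h x * exp (-F x / 2)) ^ 2 = exp (-F x) * h x ^ 2 := fun x => by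
    rw [mul_pow, ← exp_nat_mul, mul_comm]
    congr 2
    push_cast
    ring
  have hglog : ∀ x, (h x * exp (-F x / 2)) ^ 2 * log ((h x * exp (-F x / 2)) ^ 2)
      = exp (-F x) * (h x ^ 2 * log (h x ^ 2) - h x ^ 2 * F x) := fun x => by
    rw [hgsq]
    rcases eq_or_ne (h x) 0 with h0 | h0
    · simp [h0]
    · rw [log_mul (exp_pos _).ne' (by positivity), log_exp]
      ring
  have hggrad : Integrable (fun x => ‖gradient (fun y => h y * exp (-F y / 2)) x‖ ^ 2) μ :=
    ((integrable_perturb_iff hFm hnorm).1 hR).mono'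
      ((measurable_norm_gradient _).pow_const 2).aestronglyMeasurable
      (Filter.Eventually.of_forall fun x => by
        rw [norm_of_nonneg (sq_nonneg _)]
        exact norm_gradient_mul_exp_sq_le hh hF hθ x)
  obtain ⟨hfi, hle⟩ := hLS.entSq_le_of_differentiable hC hgd
    (by simp only [hgsq]; exact (integrable_perturb_iff hFm hnorm).1 hi2) hggrad
  simp only [hglog] at hfi
  have hfi' := (integrable_perturb_iff hFm hnorm).2 hfi
  have hiF : Integrable (fun x => h x ^ 2 * F x) (perturb μ F) :=
    (hil.sub hfi').congr (Filter.Eventually.of_forall fun x => by simp)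
  refine ⟨hihF, hiF, ?_⟩
  have hle2 : ∫ x, ‖gradient (fun y => h y * exp (-F y / 2)) x‖ ^ 2 ∂μ ≤
      (1 + θ⁻¹) * ∫ x, ‖gradient h x‖ ^ 2 ∂(perturb μ F)
        + (1 + θ) / 4 * ∫ x, h x ^ 2 * ‖gradient F x‖ ^ 2 ∂(perturb μ F) := by
    rw [← integral_const_mul, ← integral_const_mul, ← integral_add (hig.const_mul _)
      (hihF.const_mul _), integral_perturb hFm hnorm]
    exact integral_mono hggrad ((integrable_perturb_iff hFm hnorm).1 hR)
      (norm_gradient_mul_exp_sq_le hh hF hθ)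
  simp only [entSq, hglog] at hle
  simp only [hgsq] at hle
  rw [← integral_perturb hFm hnorm, ← integral_perturb hFm hnorm, integral_sub hil hiF] at hle
  have := mul_le_mul_of_nonneg_left hle2 hC
  simp only [entSq]
  linarith

theorem IsTestFun.norm_gradient_le {f : En n → ℝ} (hf : IsTestFun f) :
    ∃ L : ℝ, ∀ x, ‖gradient f x‖ ≤ L := by
  obtain ⟨L, hL⟩ := hf.2.2
  exact ⟨L, fun x => by rw [norm_gradient_eq]; exact norm_fderiv_le_of_lipschitz ℝ hL⟩

end Perturbation

/-- If `μ` satisfies a log-Sobolev inequality, `μ(e^{-F}) = 1`, and there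
exist `α > 1`, `β, θ > 0` with `μ_F(e^{αF}) < ∞`, `μ_F(e^{β|∇F|²}) < ∞` and
`δ := C_{LS}(μ)(1+θ)/(4β) + 1/α < 1`, then `μ_F` satisfies a log-Sobolev inequality
with the explicit constant below. -/
theorem logSobolev_of_integrable_gradient_perturbation
    {n : ℕ} (μ : Measure (En n)) [IsProbabilityMeasure μ] (V : En n → ℝ)
    (hμ : μ = volume.withDensity fun x => ENNReal.ofReal (Real.exp (-V x)))
    (F : En n → ℝ) (hFdiff : Differentiable ℝ F)
    (hnorm : ∫ x, Real.exp (-F x) ∂μ = 1)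
    (Cls : ℝ) (hCls : 0 ≤ Cls) (hLS : LogSobolevLE μ Cls)
    (α β θ : ℝ) (hα : 1 < α) (hβ : 0 < β) (hθ : 0 < θ)
    (hint1 : Integrable (fun x => Real.exp (α * F x)) (perturb μ F))
    (hint2 : Integrable (fun x => Real.exp (β * ‖gradient F x‖ ^ 2)) (perturb μ F))
    (hδ : Cls * (1 + θ) / (4 * β) + 1 / α < 1)
    (CPF : ℝ) (hCPF : 0 ≤ CPF) (hPF : PoincareLE (perturb μ F) CPF) :
    LogSobolevLE (perturb μ F)
      (1 / (1 - (Cls * (1 + θ) / (4 * β) + 1 / α)) *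
        (Cls * (1 + θ⁻¹) + CPF * (2 +
          Cls * ((1 + θ) / (4 * β)) *
            Real.log (∫ x, Real.exp (β * ‖gradient F x‖ ^ 2) ∂(perturb μ F)) +
          (1 / α) * Real.log (∫ x, Real.exp (α * F x) ∂(perturb μ F))))) := by
  have := isProbabilityMeasure_perturb hnorm
  have hFm : Measurable F := hFdiff.continuous.measurable
  have hα0 : 0 < α := one_pos.trans hα
  set ν := perturb μ F with hν
  have hA : 0 ≤ log (∫ x, exp (β * ‖gradient F x‖ ^ 2) ∂ν) := by
    refine log_nonneg ?_
    have h := integral_mono (μ := ν) (integrable_const (1 : ℝ)) hint2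
      fun x => one_le_exp (by positivity)
    simpa using h
  have hB : 0 ≤ log (∫ x, exp (α * F x) ∂ν) := by
    have hmul : ∀ x, exp (-F x) * exp (F x) = 1 := fun x => by rw [← exp_add]; simp
    have hi : Integrable (fun x => exp (F x)) ν := by
      rw [hν, integrable_perturb_iff hFm hnorm]
      simp only [hmul]
      exact integrable_const 1
    have hi1 : ∫ x, exp (F x) ∂ν = 1 := by
      rw [hν, integral_perturb hFm hnorm]
      simp [hmul]
    refine log_nonneg ?_
    have h := integral_mono (μ := ν) ((integrable_const (1 - α)).fun_add (hi.const_mul α)) hint1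
      fun x => by
        have := one_add_mul_self_le_rpow_one_add (s := exp (F x) - 1)
          (by linarith [exp_pos (F x)]) hα.le
        rw [add_sub_cancel, ← exp_mul, mul_comm (F x)] at this
        dsimp only
        linarith
    rw [integral_add (integrable_const _) (hi.const_mul α), integral_const_mul, hi1] at h
    simpa using h
  have hFgrad : Integrable (fun x => ‖gradient F x‖ ^ 2) ν := by
    refine (hint2.const_mul β⁻¹).mono' ((measurable_norm_gradient F).pow_const 2).aestronglyMeasurable
      (Filter.Eventually.of_forall fun x => ?_)
    rw [norm_of_nonneg (sq_nonneg _), le_inv_mul_iff₀ hβ]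
    linarith [add_one_le_exp (β * ‖gradient F x‖ ^ 2)]
  intro f hf
  obtain ⟨M, hM⟩ := hf.2.1
  obtain ⟨L, hL⟩ := hf.norm_gradient_le
  have hfd : Differentiable ℝ f := hf.1.differentiable (by simp)
  have hfm : Measurable f := hfd.continuous.measurable
  have hroth := entSq_le_entSq_sub_integral_add (ν := ν) hfm hM
  have hpoin := hPF f hf
  have hvar : ∫ x, (f x - ∫ y, f y ∂ν) ^ 2 ∂ν = (∫ x, f x ^ 2 ∂ν) - (∫ x, f x ∂ν) ^ 2 := by
    have h1 := ProbabilityTheory.variance_eq_sub (μ := ν) (X := f)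
      (MemLp.of_bound hfm.aestronglyMeasurable M (Filter.Eventually.of_forall hM))
    rw [ProbabilityTheory.variance_eq_integral hfm.aemeasurable] at h1
    simpa using h1
  set m := ∫ y, f y ∂ν with hm
  have hgrad : ∀ x, gradient (fun y => f y - m) x = gradient f x := fun x => by
    simp only [gradient, fderiv_sub_const]
  have hhM : ∀ x, |f x - m| ≤ M + |m| := fun x => (abs_sub _ _).trans (by linarith [hM x])
  obtain ⟨hihF, hiF, hdef⟩ := hLS.entSq_perturb_le hCls hFdiff hnorm hFgrad hθ
    (hfd.sub_const m) hhM (L := L) (fun x => by rw [hgrad]; exact hL x)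
  simp only [hgrad] at hdef
  rw [← hν] at hdef
  have he1 := integral_sq_mul_le_entSq_add (ν := ν) (φ := fun x => β * ‖gradient F x‖ ^ 2)
    (hfm.sub_const m) hhM hint2
    ((hihF.const_mul β).congr (Filter.Eventually.of_forall fun x => by simp only; ring))
  have he2 := integral_sq_mul_le_entSq_add (ν := ν) (φ := fun x => α * F x)
    (hfm.sub_const m) hhM hint1
    ((hiF.const_mul α).congr (Filter.Eventually.of_forall fun x => by simp only; ring))
  simp only [mul_left_comm _ β, mul_left_comm _ α, integral_const_mul] at he1 he2
  rw [← hvar] at hpoin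
  change entSq ν f ≤ _
  set D := ∫ x, ‖gradient f x‖ ^ 2 ∂ν
  set v := ∫ x, (f x - m) ^ 2 ∂ν
  set A := log (∫ x, exp (β * ‖gradient F x‖ ^ 2) ∂ν)
  set B := log (∫ x, exp (α * F x) ∂ν)
  set E := entSq ν fun x => f x - m
  set P := ∫ x, (f x - m) ^ 2 * ‖gradient F x‖ ^ 2 ∂ν
  set Q := ∫ x, (f x - m) ^ 2 * F x ∂ν
  have hv : 0 ≤ v := integral_nonneg fun x => sq_nonneg _
  set K := Cls * ((1 + θ) / (4 * β)) with hK
  have hK0 : 0 ≤ K := by positivity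
  have hKδ : Cls * (1 + θ) / (4 * β) = K := by rw [hK, mul_div_assoc]
  rw [hKδ] at hδ ⊢
  set c := 1 / α with hc
  have hc0 : 0 < c := by positivity
  have h1 : Cls * ((1 + θ) / 4 * P) = K * (β * P) := by
    rw [hK]
    field_simp
  have h2 : Q = c * (α * Q) := by
    rw [hc]
    field_simp
  have h3 := mul_le_mul_of_nonneg_left he1 hK0
  have h4 := mul_le_mul_of_nonneg_left he2 hc0.le
  have h5 : 0 ≤ K * A + c * B := by positivity
  have h6 := mul_le_mul_of_nonneg_right hpoin h5
  have h7 : 0 ≤ (K + c) * v := by positivity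
  have hE : (1 - (K + c)) * E ≤ Cls * (1 + θ⁻¹) * D + v * (K * A + c * B) := by
    rw [mul_add, h1] at hdef
    linarith
  have h8 := mul_le_mul_of_nonneg_left hroth (sub_pos.2 hδ).le
  rw [mul_assoc, one_div_mul_eq_div, le_div_iff₀ (sub_pos.2 hδ)]
  linarith
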